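/- Let (Y,Σ,ν) be a σ-finite measure space and let Q be a bounded linear operator on the complex Hilbert space L²(Y). Then Q is a multiplication operator if and only if Q(𝟙_A · f) = 𝟙_A · (Qf) for every f ∈ L²(Y) and every measurable set A ⊆ Y, where 𝟙_A denotes the indicator function of A. -/

import Mathlib

open MeasureTheory

/-- `Q` is a multiplication operator on `L²(Y)`: there is an essentially bounded
measurable function `m : Y → ℂ` with `Q f = m • f` a.e. for every `f`. -/
def IsMultiplicationOperator {Y : Type*} [MeasurableSpace Y] (ν : Measure Y)
    (Q : Lp ℂ 2 ν →L[ℂ] Lp ℂ 2 ν) : Prop :=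
  ∃ m : Y → ℂ, Measurable m ∧ (∃ M : ℝ, ∀ᵐ y ∂ν, ‖m y‖ ≤ M) ∧
    ∀ f : Lp ℂ 2 ν, ⇑(Q f) =ᵐ[ν] fun y => m y * f y

/-- An operator on `L²` that commutes with all indicators is local: it satisfies its norm bound
pointwise almost everywhere. -/
theorem ae_norm_apply_le_of_indicator_commutes {Y : Type*} [MeasurableSpace Y]
    {ν : Measure Y} [SigmaFinite ν] {Q : Lp ℂ 2 ν →L[ℂ] Lp ℂ 2 ν}
    (hQ : ∀ (f h : Lp ℂ 2 ν) (A : Set Y), MeasurableSet A →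
      (⇑h =ᵐ[ν] A.indicator ⇑f) → ⇑(Q h) =ᵐ[ν] A.indicator ⇑(Q f))
    (f : Lp ℂ 2 ν) : ∀ᵐ y ∂ν, ‖Q f y‖ ≤ ‖Q‖ * ‖f y‖ := by
  have hf : Measurable (⇑f) := (Lp.stronglyMeasurable f).measurable
  have hQf : Measurable (⇑(Q f)) := (Lp.stronglyMeasurable (Q f)).measurable
  have key : (fun y => ‖Q f y‖ₑ ^ ((2 : NNReal) : ℝ)) ≤ᵐ[ν]
      fun y => ‖Q‖ₑ ^ ((2 : NNReal) : ℝ) * ‖f y‖ₑ ^ ((2 : NNReal) : ℝ) := by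
    refine ae_le_of_forall_setLIntegral_le_of_sigmaFinite (by fun_prop) fun A hA _ => ?_
    have hmem := (Lp.memLp f).indicator hA
    have hle : eLpNorm (Q (hmem.toLp _)) 2 ν ≤ ‖Q‖ₑ * eLpNorm (hmem.toLp _) 2 ν := by
      simpa only [Lp.enorm_def] using Q.le_opENorm (hmem.toLp _)
    rw [eLpNorm_congr_ae (hQ f _ A hA hmem.coeFn_toLp), eLpNorm_congr_ae hmem.coeFn_toLp,
      eLpNorm_indicator_eq_eLpNorm_restrict hA, eLpNorm_indicator_eq_eLpNorm_restrict hA] at hle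
    have hpow := ENNReal.rpow_le_rpow hle (NNReal.coe_nonneg 2)
    rw [ENNReal.mul_rpow_of_nonneg _ _ (NNReal.coe_nonneg 2)] at hpow
    rw [lintegral_const_mul _ (by fun_prop)]
    have hint (u : Y → ℂ) : ∫⁻ y in A, ‖u y‖ₑ ^ ((2 : NNReal) : ℝ) ∂ν =
        eLpNorm u 2 (ν.restrict A) ^ ((2 : NNReal) : ℝ) :=
      (eLpNorm_nnreal_pow_eq_lintegral (p := 2) two_ne_zero).symm
    rwa [hint, hint]
  filter_upwards [key] with y hy
  rw [← ENNReal.mul_rpow_of_nonneg _ _ (NNReal.coe_nonneg 2),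
    ENNReal.rpow_le_rpow_iff (by norm_num), ← enorm_norm (Q f y), ← enorm_norm Q,
    ← enorm_norm (f y), ← enorm_mul, enorm_le_iff_norm_le] at hy
  simpa using hy

/-- On a `σ`-finite measure space there is an element of `L²` that vanishes almost nowhere. -/
theorem exists_Lp_two_ae_ne_zero {Y : Type*} [MeasurableSpace Y] (ν : Measure Y)
    [SigmaFinite ν] : ∃ g : Lp ℂ 2 ν, ∀ᵐ y ∂ν, g y ≠ 0 := by
  obtain ⟨w, hw_pos, hw, hw_lt⟩ := exists_pos_lintegral_lt_of_sigmaFinite ν one_ne_zero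
  have hmem : MemLp (fun y => ((NNReal.sqrt (w y) : ℝ) : ℂ)) 2 ν := by
    have hmeas : Measurable fun y => ((NNReal.sqrt (w y) : ℝ) : ℂ) :=
      Complex.measurable_ofReal.comp
        (NNReal.continuous_sqrt.measurable.comp hw).coe_nnreal_real
    refine ⟨hmeas.aestronglyMeasurable, ?_⟩
    rw [eLpNorm_lt_top_iff_lintegral_rpow_enorm_lt_top two_ne_zero ENNReal.ofNat_ne_top]
    refine lt_of_eq_of_lt (lintegral_congr fun y => ?_) (hw_lt.trans ENNReal.one_lt_top)
    have : ‖((NNReal.sqrt (w y) : ℝ) : ℂ)‖ₑ = (NNReal.sqrt (w y) : ENNReal) := by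
      rw [enorm_eq_nnnorm]
      congr 1
      ext
      simp
    rw [this, ENNReal.toReal_ofNat, ENNReal.rpow_ofNat, ← ENNReal.coe_pow, NNReal.sq_sqrt]
  refine ⟨hmem.toLp _, ?_⟩
  filter_upwards [hmem.coeFn_toLp] with y hy
  rw [hy]
  have := (hw_pos y).ne'
  simpa using this

/-- A linear operator on `L²` that is pointwise bounded satisfies `g * Q f = f * Q g`, written
as multiplication by `Q g / g` where `g` does not vanish. -/
theorem ae_apply_eq_div_mul {Y : Type*} [MeasurableSpace Y] {ν : Measure Y}
    {Q : Lp ℂ 2 ν →L[ℂ] Lp ℂ 2 ν} {C : ℝ}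
    (hQ : ∀ f : Lp ℂ 2 ν, ∀ᵐ y ∂ν, ‖Q f y‖ ≤ C * ‖f y‖)
    {g : Lp ℂ 2 ν} (hg : ∀ᵐ y ∂ν, g y ≠ 0) (f : Lp ℂ 2 ν) :
    ⇑(Q f) =ᵐ[ν] fun y => Q g y / g y * f y := by
  have hcount : ∀ᵐ y ∂ν, ∀ n : ℕ,
      ‖Q f y - TopologicalSpace.denseSeq ℂ n * Q g y‖
        ≤ C * ‖f y - TopologicalSpace.denseSeq ℂ n * g y‖ := by
    refine ae_all_iff.2 fun n => ?_
    set c := TopologicalSpace.denseSeq ℂ n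
    have hbound := hQ (f - c • g)
    rw [map_sub, map_smul] at hbound
    filter_upwards [hbound, Lp.coeFn_sub (Q f) (c • Q g), Lp.coeFn_smul c (Q g),
      Lp.coeFn_sub f (c • g), Lp.coeFn_smul c g] with y h h₁ h₂ h₃ h₄
    rwa [h₁, h₃, Pi.sub_apply, Pi.sub_apply, h₂, h₄] at h
  filter_upwards [hcount, hg] with y hy hgy
  have hall : ∀ c : ℂ, ‖Q f y - c * Q g y‖ ≤ C * ‖f y - c * g y‖ := fun c =>
    (TopologicalSpace.denseRange_denseSeq ℂ).induction_on
      (p := fun c => ‖Q f y - c * Q g y‖ ≤ C * ‖f y - c * g y‖) c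
      (isClosed_le (by fun_prop) (by fun_prop)) hy
  have hzero := hall (f y / g y)
  rw [div_mul_cancel₀ _ hgy, sub_self, norm_zero, mul_zero, norm_le_zero_iff, sub_eq_zero] at hzero
  rw [hzero]
  ring

/-- `Q` is a multiplication operator iff `Q (𝟙_A · f) = 𝟙_A · (Q f)` for every
`f ∈ L²(Y)` and every measurable `A ⊆ Y`; here the element `𝟙_A · f` of `L²` is
represented by any `h ∈ L²(Y)` whose representative equals `A.indicator f` a.e. -/
theorem multiplication_iff_indicator_commutes {Y : Type*} [MeasurableSpace Y]
    (ν : Measure Y) [SigmaFinite ν] (Q : Lp ℂ 2 ν →L[ℂ] Lp ℂ 2 ν) :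
    IsMultiplicationOperator ν Q ↔
      ∀ (f h : Lp ℂ 2 ν) (A : Set Y), MeasurableSet A →
        (⇑h =ᵐ[ν] A.indicator ⇑f) → ⇑(Q h) =ᵐ[ν] A.indicator ⇑(Q f) := by
  constructor
  · rintro ⟨m, -, -, hm⟩ f h A - hh
    filter_upwards [hm h, hm f, hh] with y h₁ h₂ h₃
    by_cases hy : y ∈ A <;> simp [h₁, h₂, h₃, hy]
  · intro hQ
    have hbound := ae_norm_apply_le_of_indicator_commutes hQ
    obtain ⟨g, hg⟩ := exists_Lp_two_ae_ne_zero ν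
    refine ⟨fun y => Q g y / g y, (Lp.stronglyMeasurable (Q g)).measurable.div
      (Lp.stronglyMeasurable g).measurable, ⟨‖Q‖, ?_⟩, ae_apply_eq_div_mul hbound hg⟩
    filter_upwards [hbound g, hg] with y h hgy
    rw [norm_div]
    exact (div_le_iff₀ (norm_pos_iff.2 hgy)).2 h
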